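/- arXiv:1902.06164 — 3 statements merged into one kernel-verified Lean document; each statement's English description precedes it below -/
import Mathlib

section
/- Let α > 0, let d ≥ 144/α², and let G be a bipartite d-regular graph with parts V₁ and V₂, |V₁| = |V₂| = n, satisfying the expander mixing property: for all A ⊆ V₁ and B ⊆ V₂, |e(A,B) − (d/n)|A||B|| ≤ 2√(d−1) · √(|A||B|). Suppose U ⊆ V₁ and W ⊆ V₂ satisfy |U| = |W| = αn, deg(w, U) ≥ αd/3 for every w ∈ W, and deg(u, W) ≥ αd/3 for every u ∈ U. Then the bipartite graph induced by G on (U, W) contains a perfect matching (a matching covering all of U and all of W). -/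
open Finset

/-- The number of pairs of a product satisfying a relation, counted by first coordinate. -/
lemma card_filter_product_eq_sum_left {α β : Type*} (E : α → β → Prop) [∀ a b, Decidable (E a b)]
    (A : Finset α) (B : Finset β) :
    ((A ×ˢ B).filter fun e => E e.1 e.2).card = ∑ a ∈ A, (B.filter fun b => E a b).card := by
  simp only [card_filter, sum_product]

/-- The number of pairs of a product satisfying a relation, counted by second coordinate. -/
lemma card_filter_product_eq_sum_right {α β : Type*} (E : α → β → Prop)
    [∀ a b, Decidable (E a b)] (A : Finset α) (B : Finset β) :
    ((A ×ˢ B).filter fun e => E e.1 e.2).card = ∑ b ∈ B, (A.filter fun a => E a b).card := by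
  simp only [card_filter, sum_product_right]

/-- If the smaller of two sets has at most `α n / 6` elements, the mixing upper bound on the number
of edges is below `α d / 3` times the size of the larger set. -/
lemma mixing_bound_lt {n d α s a b : ℝ} (hn : 0 < n) (hd : 0 ≤ d) (hs : 0 ≤ s)
    (hsd : 12 * s < α * d) (ha : 0 < a) (hba : b ≤ a) (hbn : b ≤ α * n / 6) :
    d / n * a * b + 2 * s * √(a * b) < α * d / 3 * a := by
  have h1 : √(a * b) ≤ a := Real.sqrt_le_iff.2 ⟨ha.le, by nlinarith⟩
  have h2 : d / n * a * b ≤ d / n * a * (α * n / 6) := by gcongr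
  have h3 : d / n * a * (α * n / 6) = α * d / 6 * a := by field_simp
  have h4 : 2 * s * √(a * b) ≤ 2 * s * a := by gcongr
  nlinarith

/-- Two sets with more than `α n / 6` elements each violate the mixing bound if no edge joins
them. -/
lemma mixing_bound_lt_of_large {n d α s a c : ℝ} (hn : 0 < n) (hα : 0 < α) (hs : 0 ≤ s)
    (hsd : 12 * s < α * d) (ha : α * n / 6 < a) (hc : α * n / 6 < c) :
    2 * s * √(a * c) < d / n * a * c := by
  have hm : 0 < α * n / 6 := by positivity
  have ha0 : 0 < a := hm.trans ha
  have hc0 : 0 < c := hm.trans hc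
  have hr : α * n / 6 < √(a * c) := Real.lt_sqrt_of_sq_lt (by nlinarith)
  have hr2 : √(a * c) * √(a * c) = a * c := Real.mul_self_sqrt (by positivity)
  have hd : 0 < d := by
    by_contra! h
    nlinarith
  calc 2 * s * √(a * c) < α * d / 6 * √(a * c) := by
        have := hm.trans hr
        gcongr
        linarith
    _ = d / n * (α * n / 6) * √(a * c) := by field_simp
    _ ≤ d / n * √(a * c) * √(a * c) := by gcongr
    _ = d / n * a * c := by rw [mul_assoc, hr2, mul_assoc]

/-- Hall's condition inside `(U, W)` for a bipartite graph with the mixing property. -/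
lemma card_le_card_neighbors_of_mixing {V₁ V₂ : Type*} [DecidableEq V₁] [DecidableEq V₂]
    (E : V₁ → V₂ → Prop) [∀ u w, Decidable (E u w)] {n d α s : ℝ}
    (hn : 0 < n) (hα : 0 < α) (hd : 0 ≤ d) (hs : 0 ≤ s) (hsd : 12 * s < α * d)
    (hmix : ∀ (A : Finset V₁) (B : Finset V₂),
      |(((A ×ˢ B).filter fun e => E e.1 e.2).card : ℝ) - d / n * A.card * B.card|
        ≤ 2 * s * √((A.card : ℝ) * B.card))
    {U : Finset V₁} {W : Finset V₂} (hU : (U.card : ℝ) = α * n) (hW : (W.card : ℝ) = α * n)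
    (hdegW : ∀ w ∈ W, α * d / 3 ≤ ((U.filter fun u => E u w).card : ℝ))
    (hdegU : ∀ u ∈ U, α * d / 3 ≤ ((W.filter fun w => E u w).card : ℝ))
    {A : Finset V₁} (hA : A ⊆ U) :
    A.card ≤ (W.filter fun w => ∃ u ∈ A, E u w).card := by
  by_contra! hlt
  set B := W.filter fun w => ∃ u ∈ A, E u w with hB
  have hBW : B ⊆ W := filter_subset _ _
  have hlt' : (B.card : ℝ) < A.card := by exact_mod_cast hlt
  have hUA : ((U \ A).card : ℝ) = α * n - A.card := by rw [cast_card_sdiff hA, hU]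
  have hWB : ((W \ B).card : ℝ) = α * n - B.card := by rw [cast_card_sdiff hBW, hW]
  by_cases hsmall : (B.card : ℝ) ≤ α * n / 6
  · have hcount : α * d / 3 * A.card ≤ (((A ×ˢ B).filter fun e => E e.1 e.2).card : ℝ) := by
      rw [card_filter_product_eq_sum_left, mul_comm, ← nsmul_eq_mul, Nat.cast_sum]
      refine card_nsmul_le_sum _ _ _ fun u hu => (hdegU u (hA hu)).trans ?_
      gcongr 1
      refine card_le_card fun w hw => ?_
      simp only [hB, mem_filter] at hw ⊢
      exact ⟨⟨hw.1, u, hu, hw.2⟩, hw.2⟩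
    have hA0 : (0 : ℝ) < A.card := lt_of_le_of_lt (Nat.cast_nonneg _) hlt'
    have := mixing_bound_lt hn hd hs hsd hA0 hlt'.le hsmall
    linarith [(abs_le.1 (hmix A B)).2]
  by_cases hlarge : ((U \ A).card : ℝ) ≤ α * n / 6
  · have hcount : α * d / 3 * (W \ B).card ≤
        ((((U \ A) ×ˢ (W \ B)).filter fun e => E e.1 e.2).card : ℝ) := by
      rw [card_filter_product_eq_sum_right, mul_comm, ← nsmul_eq_mul, Nat.cast_sum]
      refine card_nsmul_le_sum _ _ _ fun w hw => ?_
      obtain ⟨hwW, hwB⟩ := mem_sdiff.1 hw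
      refine (hdegW w hwW).trans ?_
      gcongr 1
      refine card_le_card fun u hu => ?_
      simp only [hB, mem_filter, mem_sdiff] at hu hwB ⊢
      exact ⟨⟨hu.1, fun huA => hwB ⟨hwW, u, huA, hu.2⟩⟩, hu.2⟩
    have hle : ((U \ A).card : ℝ) < (W \ B).card := by linarith
    have hpos : (0 : ℝ) < (W \ B).card := lt_of_le_of_lt (Nat.cast_nonneg _) hle
    have := mixing_bound_lt hn hd hs hsd hpos hle.le hlarge
    have hup := (abs_le.1 (hmix (U \ A) (W \ B))).2
    rw [mul_right_comm (d / n), mul_comm ((U \ A).card : ℝ) ((W \ B).card : ℝ)] at hup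
    linarith
  · have hzero : ((A ×ˢ (W \ B)).filter fun e => E e.1 e.2).card = 0 := by
      rw [card_eq_zero, filter_eq_empty_iff]
      rintro ⟨u, w⟩ huw hE
      simp only [hB, mem_product, mem_sdiff, mem_filter] at huw
      exact huw.2.2 ⟨huw.2.1, u, huw.1, hE⟩
    push Not at hsmall hlarge
    have := mixing_bound_lt_of_large (a := A.card) (c := (W \ B).card) hn hα hs hsd
      (by linarith) (by linarith)
    have hlow := (abs_le.1 (hmix A (W \ B))).1
    rw [hzero, Nat.cast_zero] at hlow
    linarith

/-- Hall's theorem for perfect matchings between two finsets of the same size. -/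
lemma exists_perfect_matching_of_hall {V₁ V₂ : Type*} [DecidableEq V₁] [DecidableEq V₂]
    (E : V₁ → V₂ → Prop) [∀ u w, Decidable (E u w)] (f₀ : V₁ → V₂)
    {U : Finset V₁} {W : Finset V₂} (hUW : U.card = W.card)
    (hall : ∀ A ⊆ U, A.card ≤ (W.filter fun w => ∃ u ∈ A, E u w).card) :
    ∃ f : V₁ → V₂, Set.InjOn f ↑U ∧ (∀ u ∈ U, f u ∈ W ∧ E u (f u)) ∧
      ∀ w ∈ W, ∃ u ∈ U, f u = w := by
  obtain ⟨g, hginj, hg⟩ := (all_card_le_biUnion_card_iff_exists_injective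
    fun u : U => W.filter fun w => E u w).1 fun s => by
      have h := hall (s.map (Function.Embedding.subtype _)) (map_subtype_subset s)
      rw [card_map] at h
      refine h.trans (card_le_card fun w hw => ?_)
      simp only [mem_filter, mem_map, Function.Embedding.subtype_apply, mem_biUnion] at hw ⊢
      obtain ⟨hwW, _, ⟨u, hu, rfl⟩, hE⟩ := hw
      exact ⟨u, hu, hwW, hE⟩
  have hf : ∀ u (hu : u ∈ U), (if h : u ∈ U then g ⟨u, h⟩ else f₀ u) = g ⟨u, hu⟩ :=
    fun u hu => dif_pos hu
  have hinj : Set.InjOn (fun u => if h : u ∈ U then g ⟨u, h⟩ else f₀ u) (U : Set V₁) := by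
    intro u hu v hv huv
    simp only [hf u hu, hf v hv] at huv
    exact congrArg Subtype.val (hginj huv)
  have hmem : ∀ u ∈ U, (if h : u ∈ U then g ⟨u, h⟩ else f₀ u) ∈ W ∧
      E u (if h : u ∈ U then g ⟨u, h⟩ else f₀ u) := fun u hu => by
    rw [hf u hu]
    exact mem_filter.1 (hg ⟨u, hu⟩)
  exact ⟨_, hinj, hmem,
    surjOn_of_injOn_of_card_le _ (fun u hu => (hmem u hu).1) hinj hUW.ge⟩

/-- let `G` be a bipartite `d`-regular graph with parts `V₁, V₂` of size
`n` (given by an adjacency relation `E : V₁ → V₂ → Prop`) satisfying the expander mixing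
property with constant `2√(d−1)`. If `d ≥ 144/α²`, `U ⊆ V₁` and `W ⊆ V₂` have size
`αn`, and every vertex of `W` has at least `αd/3` neighbours in `U` and vice versa, then
the bipartite graph induced on `(U,W)` has a perfect matching. -/
theorem stmt15 {V₁ V₂ : Type} [Fintype V₁] [DecidableEq V₁] [Fintype V₂] [DecidableEq V₂]
    (E : V₁ → V₂ → Prop) [∀ u w, Decidable (E u w)]
    (n d : ℕ) (α : ℝ) (hα : 0 < α)
    (hn1 : Fintype.card V₁ = n) (hn2 : Fintype.card V₂ = n)
    (hd : 144 / α ^ 2 ≤ (d : ℝ))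
    (hreg1 : ∀ u : V₁, (Finset.univ.filter fun w => E u w).card = d)
    (hreg2 : ∀ w : V₂, (Finset.univ.filter fun u => E u w).card = d)
    (hmix : ∀ (A : Finset V₁) (B : Finset V₂),
      |(((A ×ˢ B).filter fun e => E e.1 e.2).card : ℝ)
          - ((d : ℝ) / n) * A.card * B.card|
        ≤ 2 * Real.sqrt ((d : ℝ) - 1) * Real.sqrt ((A.card : ℝ) * B.card))
    (U : Finset V₁) (W : Finset V₂)
    (hU : (U.card : ℝ) = α * n) (hW : (W.card : ℝ) = α * n)
    (hdegW : ∀ w ∈ W, α * d / 3 ≤ ((U.filter fun u => E u w).card : ℝ))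
    (hdegU : ∀ u ∈ U, α * d / 3 ≤ ((W.filter fun w => E u w).card : ℝ)) :
    ∃ f : V₁ → V₂, Set.InjOn f ↑U ∧ (∀ u ∈ U, f u ∈ W ∧ E u (f u)) ∧
      ∀ w ∈ W, ∃ u ∈ U, f u = w := by
  have hd0 : (0 : ℝ) < d := lt_of_lt_of_le (by positivity) hd
  have hd1 : (1 : ℝ) ≤ d := by exact_mod_cast hd0
  have hs2 : √((d : ℝ) - 1) ^ 2 = d - 1 := Real.sq_sqrt (by linarith)
  have hsd : 12 * √((d : ℝ) - 1) < α * d := by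
    rw [div_le_iff₀ (by positivity)] at hd
    refine lt_of_pow_lt_pow_left₀ 2 (by positivity) ?_
    nlinarith
  refine exists_perfect_matching_of_hall E (Fintype.equivOfCardEq (hn1.trans hn2.symm))
    (by exact_mod_cast hU.trans hW.symm) fun A hA => ?_
  rcases A.eq_empty_or_nonempty with rfl | ⟨u, -⟩
  · simp
  have hn : (0 : ℝ) < n := by
    rw [← hn1]
    exact_mod_cast Fintype.card_pos_iff.2 ⟨u⟩
  exact card_le_card_neighbors_of_mixing E hn hα hd0.le (Real.sqrt_nonneg _) hsd hmix hU hW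
    hdegW hdegU hA
end

section
/- Let q ≡ 1 (mod 4) be a prime with q ≥ 68000. Then for every sufficiently large integer m there exists a template with flexibility m and maximum degree at most q + 1; that is, a bipartite graph T on 7m vertices with parts I and J = J₁ ∪ J₂ (J₁, J₂ disjoint), |I| = 3m, |J₁| = |J₂| = 2m, Δ(T) ≤ q + 1, such that for every subset J̄ ⊆ J₁ with |J̄| = m, the induced subgraph T[V(T) ∖ J̄] has a perfect matching. -/
open Finset

/-- The number of permutations mapping `X` into `Y` is at most `(|Y| / |α|) ^ |X|` times the number
of all permutations. -/
theorem card_perm_mapsTo_mul_le {α : Type*} [Fintype α] [DecidableEq α] (X Y : Finset α) :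
    #{σ : Equiv.Perm α | ∀ a ∈ X, σ a ∈ Y} * Fintype.card α ^ #X ≤
      #Y ^ #X * (Fintype.card α).factorial := by
  induction X using Finset.induction_on with
  | empty => simp [Fintype.card_perm]
  | insert a X ha ih =>
    set P : Finset (Equiv.Perm α) := {σ | ∀ b ∈ X, σ b ∈ Y} with hP
    set S : Finset (Equiv.Perm α) := {σ | ∀ b ∈ insert a X, σ b ∈ Y} with hS
    have hsum : ∑ b : α, #{σ ∈ P | σ b ∈ Y} = #Y * #P := by
      have h1 : ∀ σ ∈ P, #{b : α | σ b ∈ Y} = #Y := fun σ _ => by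
        have : ({b : α | σ b ∈ Y} : Finset α) = Y.map σ⁻¹.toEmbedding := by
          ext b
          simp only [mem_filter, mem_univ, true_and, mem_map_equiv]
          rfl
        rw [this, card_map]
      simp only [card_filter] at h1 ⊢
      rw [sum_comm, sum_congr rfl h1, sum_const, smul_eq_mul, mul_comm]
    have hle : ∀ b : α, #S ≤ #{σ ∈ P | σ b ∈ Y} := by
      intro b
      by_cases hb : b ∈ X
      · refine card_le_card fun σ hσ => ?_
        simp only [hS, hP, mem_filter, mem_univ, true_and, mem_insert, forall_eq_or_imp] at hσ ⊢
        exact ⟨hσ.2, hσ.2 b hb⟩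
      · refine card_le_card_of_injOn (fun σ => σ * Equiv.swap a b) (fun σ hσ => ?_)
          (fun σ _ τ _ h => mul_right_cancel h)
        simp only [hS, hP, coe_filter, mem_filter, mem_univ, true_and, mem_insert,
          forall_eq_or_imp, Set.mem_ofPred_eq, Equiv.Perm.coe_mul, Function.comp_apply,
          Equiv.swap_apply_right] at hσ ⊢
        refine ⟨fun c hc => ?_, hσ.1⟩
        rw [Equiv.swap_apply_of_ne_of_ne (ne_of_mem_of_not_mem hc ha) (ne_of_mem_of_not_mem hc hb)]
        exact hσ.2 c hc
    have hmul : Fintype.card α * #S ≤ #Y * #P := by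
      rw [← hsum]
      simpa using card_nsmul_le_sum univ _ #S fun b _ => hle b
    rw [card_insert_of_notMem ha, pow_succ, pow_succ]
    calc #S * (Fintype.card α ^ #X * Fintype.card α)
        = Fintype.card α * #S * Fintype.card α ^ #X := by ring
      _ ≤ #Y * #P * Fintype.card α ^ #X := by gcongr
      _ = #Y * (#P * Fintype.card α ^ #X) := by ring
      _ ≤ #Y * (#Y ^ #X * (Fintype.card α).factorial) := by gcongr
      _ = #Y ^ #X * #Y * (Fintype.card α).factorial := by ring

theorem choose_le_three_mul_div_pow (n k : ℕ) (hk : 0 < k) :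
    (n.choose k : ℝ) ≤ (3 * n / k) ^ k := by
  have hk' : (0 : ℝ) < k := by exact_mod_cast hk
  have h1 : (k : ℝ) ^ k / k.factorial ≤ 3 ^ k := by
    refine (Real.pow_div_factorial_le_exp (k : ℝ) hk'.le k).trans ?_
    rw [← Real.exp_one_pow]
    gcongr
    exact Real.exp_one_lt_three.le
  have hf : (0 : ℝ) < k.factorial := by exact_mod_cast k.factorial_pos
  calc (n.choose k : ℝ) ≤ n ^ k / k.factorial := Nat.choose_le_pow_div k n
    _ = (n / k) ^ k * (k ^ k / k.factorial) := by rw [div_pow]; field_simp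
    _ ≤ (n / k) ^ k * 3 ^ k := by gcongr
    _ = (3 * n / k) ^ k := by rw [← mul_pow]; ring

theorem choose_mul_choose_mul_pow_le {N x y : ℕ} (hx : 0 < x) (hxy : x ≤ y) (hyx : 2 * y ≤ 3 * x)
    (hN : 5 * x ≤ 3 * N) :
    (N.choose x : ℝ) * N.choose y * (((y : ℝ) / N) ^ x) ^ 100 ≤ (1 / 3) ^ x := by
  have hx' : (0 : ℝ) < x := by exact_mod_cast hx
  have hxy' : (x : ℝ) ≤ y := by exact_mod_cast hxy
  have hyx' : 2 * (y : ℝ) ≤ 3 * x := by exact_mod_cast hyx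
  have hN' : 5 * (x : ℝ) ≤ 3 * N := by exact_mod_cast hN
  have hN0 : (0 : ℝ) < N := by linarith
  set r : ℝ := N / x with hr
  have hr1 : 5 / 3 ≤ r := by rw [hr, le_div_iff₀ hx']; linarith
  have hr0 : 0 < r := by linarith
  have h1 : (N.choose x : ℝ) ≤ (3 * r) ^ x := by
    simpa [hr, mul_div_assoc] using choose_le_three_mul_div_pow N x hx
  have h2 : (N.choose y : ℝ) ≤ ((3 * r) ^ 2) ^ x := by
    calc (N.choose y : ℝ) ≤ (3 * N / y) ^ y := choose_le_three_mul_div_pow N y (by omega)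
      _ ≤ (3 * r) ^ y := by rw [hr, ← mul_div_assoc]; gcongr
      _ ≤ (3 * r) ^ (2 * x) := pow_le_pow_right₀ (by linarith) (by omega)
      _ = _ := by rw [pow_mul]
  have h3 : (y : ℝ) / N ≤ 3 / 2 / r := by
    rw [hr, div_div_eq_mul_div, div_le_div_iff_of_pos_right hN0]; linarith
  calc (N.choose x : ℝ) * N.choose y * (((y : ℝ) / N) ^ x) ^ 100
      ≤ (3 * r) ^ x * ((3 * r) ^ 2) ^ x * ((3 / 2 / r) ^ x) ^ 100 := by gcongr
    _ = (729 / 8 * (3 / 2 / r) ^ 97) ^ x := by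
      rw [pow_right_comm (3 / 2 / r), ← mul_pow, ← mul_pow]
      congr 1
      field_simp
      norm_num
    _ ≤ (729 / 8 * (9 / 10) ^ 97) ^ x := by
      have : 3 / 2 / r ≤ 9 / 10 := by rw [div_le_iff₀ hr0]; linarith
      gcongr
    _ ≤ (1 / 3) ^ x := by gcongr; norm_num

theorem sum_Icc_third_pow_lt_one (n : ℕ) : ∑ x ∈ Icc 1 n, (1 / 3 : ℝ) ^ x < 1 := by
  have : ∑ x ∈ Icc 1 n, (1 / 3 : ℝ) ^ x = 1 / 2 - 1 / 2 * (1 / 3) ^ n := by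
    induction n with
    | zero => simp
    | succ n ih => rw [sum_Icc_succ_top (by omega), ih]; ring
  rw [this]
  have : (0 : ℝ) < (1 / 3) ^ n := by positivity
  linarith

/-- There are 100 permutations whose union expands all not too large sets by a factor `3 / 2`. -/
theorem exists_expanding_perms (α : Type*) [Fintype α] [DecidableEq α] :
    ∃ σ : Fin 100 → Equiv.Perm α, ∀ X : Finset α, 5 * #X ≤ 3 * Fintype.card α →
      3 * #X ≤ 2 * #(univ.biUnion fun i => X.image (σ i)) := by
  by_contra! hcon
  set N := Fintype.card α with hN
  let C (X Y : Finset α) : Finset (Equiv.Perm α) := {σ | ∀ a ∈ X, σ a ∈ Y}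
  have hcover : (univ : Finset (Fin 100 → Equiv.Perm α)) ⊆
      ({x ∈ Icc 1 N | 5 * x ≤ 3 * N} : Finset ℕ).biUnion fun x =>
        (powersetCard x univ ×ˢ powersetCard (3 * x / 2) univ).biUnion fun p =>
          Fintype.piFinset fun _ => C p.1 p.2 := by
    intro σ _
    obtain ⟨X, hX, hlt⟩ := hcon σ
    have hXN : #X ≤ N := card_le_univ X
    obtain ⟨Y, hY, hYc⟩ := exists_superset_card_eq
      (s := univ.biUnion fun i => X.image (σ i)) (n := 3 * #X / 2) (by omega) (by omega)
    simp only [mem_biUnion, mem_filter, mem_Icc, mem_product, mem_powersetCard, subset_univ,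
      true_and, Fintype.mem_piFinset]
    refine ⟨#X, ⟨⟨by omega, hXN⟩, hX⟩, (X, Y), ⟨rfl, hYc⟩, fun i => ?_⟩
    simp only [C, mem_filter, mem_univ, true_and]
    exact fun a ha => hY (mem_biUnion.2 ⟨i, mem_univ _, mem_image_of_mem _ ha⟩)
  have hF : (0 : ℝ) < (N.factorial : ℝ) ^ 100 := by positivity
  have hcard : ((N.factorial : ℝ)) ^ 100 ≤
      ∑ x ∈ Icc 1 N with 5 * x ≤ 3 * N, (1 / 3 : ℝ) ^ x * (N.factorial : ℝ) ^ 100 := by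
    have h := (card_le_card hcover).trans card_biUnion_le
    have hu : #(univ : Finset (Fin 100 → Equiv.Perm α)) = N.factorial ^ 100 := by
      simp [Fintype.card_perm, hN]
    rw [hu] at h
    replace h := (Nat.cast_le (α := ℝ)).2 h
    push_cast at h
    refine h.trans ?_
    refine sum_le_sum fun x hx => ?_
    simp only [mem_filter, mem_Icc] at hx
    have hN0 : (0 : ℝ) < N := by exact_mod_cast (by omega : 0 < N)
    refine (Nat.cast_le.2 card_biUnion_le).trans ?_
    push_cast
    have hterm : ∀ p ∈ powersetCard x (univ : Finset α) ×ˢ powersetCard (3 * x / 2) univ,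
        (#(Fintype.piFinset fun _ : Fin 100 => C p.1 p.2) : ℝ) ≤
          ((((3 * x / 2 : ℕ) : ℝ) / N) ^ x * N.factorial) ^ 100 := by
      intro p hp
      simp only [mem_product, mem_powersetCard, subset_univ, true_and] at hp
      rw [Fintype.card_piFinset_const, Nat.cast_pow]
      gcongr
      have := card_perm_mapsTo_mul_le p.1 p.2
      rw [hp.1, hp.2, ← hN] at this
      rw [div_pow, div_mul_eq_mul_div, le_div_iff₀ (by positivity)]
      exact_mod_cast this
    refine (sum_le_card_nsmul _ _ _ hterm).trans ?_
    rw [card_product, card_powersetCard, card_powersetCard, card_univ, ← hN, nsmul_eq_mul,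
      mul_pow, ← mul_assoc]
    gcongr
    push_cast [-Nat.cast_ofNat]
    exact choose_mul_choose_mul_pow_le (by omega) (by omega) (by omega) hx.2
  rw [← sum_mul] at hcard
  have h1 : ∑ x ∈ Icc 1 N with 5 * x ≤ 3 * N, (1 / 3 : ℝ) ^ x ≤ ∑ x ∈ Icc 1 N, (1 / 3 : ℝ) ^ x :=
    sum_le_sum_of_subset_of_nonneg (filter_subset _ _) fun _ _ _ => by positivity
  have h2 := sum_Icc_third_pow_lt_one N
  nlinarith

/-- A bounded degree bipartite graph between `3m` and `2m` vertices, in which sets of moderate size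
on either side have many neighbours. -/
theorem exists_biexpander {m : ℕ} (hm : 10 ≤ m) :
    ∃ E : Fin (3 * m) → Fin (2 * m) → Prop,
      (∀ i, {v | E i v}.ncard ≤ 400) ∧ (∀ v, {i | E i v}.ncard ≤ 600) ∧
      (∀ A : Finset (Fin (3 * m)), 2 * #A ≤ 3 * m → #A ≤ {v | ∃ i ∈ A, E i v}.ncard) ∧
      ∀ B : Finset (Fin (2 * m)), 4 * #B ≤ 3 * m + 3 → 2 * #B ≤ {i | ∃ v ∈ B, E i v}.ncard := by
  let e : Fin (3 * m) × Fin 2 ≃ Fin (2 * m) × Fin 3 :=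
    Fintype.equivOfCardEq (by simp; ring)
  obtain ⟨σ, hσ⟩ := exists_expanding_perms (Fin (3 * m) × Fin 2)
  have hcard : Fintype.card (Fin (3 * m) × Fin 2) = 6 * m := by simp; ring
  rw [hcard] at hσ
  let τ : Fin 100 × Bool → Equiv.Perm (Fin (3 * m) × Fin 2) :=
    fun k => if k.2 then σ k.1 else (σ k.1)⁻¹
  refine ⟨fun i v => ∃ k c, (e (τ k (i, c))).1 = v, fun i => ?_, fun v => ?_, fun A hA => ?_,
    fun B hB => ?_⟩
  · have : {v | ∃ k c, (e (τ k (i, c))).1 = v} =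
        Set.range fun p : (Fin 100 × Bool) × Fin 2 => (e (τ p.1 (i, p.2))).1 := by
      ext v; simp
    rw [this, ← Set.image_univ]
    refine (Set.ncard_image_le Set.finite_univ).trans ?_
    simp [Set.ncard_univ]
  · have : {i | ∃ k c, (e (τ k (i, c))).1 = v} ⊆
        Set.range fun p : (Fin 100 × Bool) × Fin 3 => ((τ p.1)⁻¹ (e.symm (v, p.2))).1 := by
      rintro i ⟨k, c, h⟩
      refine ⟨(k, (e (τ k (i, c))).2), ?_⟩
      simp [← h]
    refine (Set.ncard_le_ncard this).trans ?_
    rw [← Set.image_univ]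
    refine (Set.ncard_image_le Set.finite_univ).trans ?_
    simp [Set.ncard_univ]
  · have h := hσ (A ×ˢ univ) (by simp; omega)
    set U := univ.biUnion fun i => (A ×ˢ univ).image (σ i)
    have hU : #U ≤ 3 * #(U.image fun x => (e x).1) := by
      refine card_le_mul_card_image _ 3 fun v _ => ?_
      refine (card_le_card_of_injOn (t := univ) (fun x => (e x).2) (by simp) ?_).trans
        (Fintype.card_fin 3).le
      intro x hx y hy hxy
      simp only [coe_filter, Set.mem_ofPred_eq] at hx hy
      exact e.injective (Prod.ext (hx.2.trans hy.2.symm) hxy)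
    have hsub : ((U.image fun x => (e x).1 : Finset _) : Set (Fin (2 * m))) ⊆
        {v | ∃ i ∈ A, ∃ k c, (e (τ k (i, c))).1 = v} := by
      intro v hv
      simp only [U, coe_image, Set.mem_image, mem_coe, mem_biUnion, mem_univ, true_and,
        mem_image, mem_product, and_true] at hv
      obtain ⟨_, ⟨k, x, hx, rfl⟩, rfl⟩ := hv
      exact ⟨x.1, hx, (k, true), x.2, by simp [τ]⟩
    have := Set.ncard_le_ncard hsub
    rw [Set.ncard_coe_finset] at this
    simp only [card_product, card_univ, Fintype.card_fin] at h
    refine le_trans ?_ this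
    omega
  · have h := hσ ((B ×ˢ univ).map e.symm.toEmbedding) (by simp; omega)
    set U := univ.biUnion fun i => ((B ×ˢ univ).map e.symm.toEmbedding).image (σ i)
    have hU : #U ≤ 2 * #(U.image Prod.fst) := by
      refine card_le_mul_card_image _ 2 fun v _ => ?_
      refine (card_le_card_of_injOn (t := univ) Prod.snd (by simp) ?_).trans
        (Fintype.card_fin 2).le
      intro x hx y hy hxy
      simp only [coe_filter, Set.mem_ofPred_eq] at hx hy
      exact Prod.ext (hx.2.trans hy.2.symm) hxy
    have hsub : ((U.image Prod.fst : Finset _) : Set (Fin (3 * m))) ⊆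
        {i | ∃ v ∈ B, ∃ k c, (e (τ k (i, c))).1 = v} := by
      intro i hi
      simp only [U, coe_image, Set.mem_image, mem_coe, mem_biUnion, mem_univ, true_and,
        mem_image, mem_map, mem_product, and_true] at hi
      obtain ⟨_, ⟨k, _, ⟨x, hx, rfl⟩, rfl⟩, rfl⟩ := hi
      exact ⟨x.1, hx, (k, false), (σ k (e.symm x)).2, by simp [τ]⟩
    have := Set.ncard_le_ncard hsub
    rw [Set.ncard_coe_finset] at this
    simp only [card_map, card_product, card_univ, Fintype.card_fin] at h
    refine le_trans ?_ this
    omega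

/-- for every prime `q ≡ 1 (mod 4)` with `q ≥ 68000` and every
sufficiently large `m`, there is a template with flexibility `m` and maximum degree at
most `q + 1`: a bipartite graph `T` with parts `I = Fin (3m)` and `J = Fin (4m)`
(where `J₁` consists of the `2m` elements `j` with `j < 2m`), all degrees at most
`q + 1`, such that for every `J̄ ⊆ J₁` with `|J̄| = m`, the graph obtained by removing
`J̄` has a perfect matching (an injection `f : I → J ∖ J̄` along edges of `T`; since
`|I| = 3m = |J ∖ J̄|`, this matching covers both sides). -/
theorem stmt16 (q : ℕ) (hq : q.Prime) (hq4 : q % 4 = 1) (hq0 : 68000 ≤ q) :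
    ∃ m₀ : ℕ, ∀ m : ℕ, m₀ ≤ m →
    ∃ T : Finset (Fin (3 * m) × Fin (4 * m)),
      (∀ i : Fin (3 * m), (T.filter fun e => e.1 = i).card ≤ q + 1) ∧
      (∀ j : Fin (4 * m), (T.filter fun e => e.2 = j).card ≤ q + 1) ∧
      ∀ Jbar : Finset (Fin (4 * m)),
        (∀ j ∈ Jbar, (j : ℕ) < 2 * m) → Jbar.card = m →
        ∃ f : Fin (3 * m) → Fin (4 * m), Function.Injective f ∧
          ∀ i, (i, f i) ∈ T ∧ f i ∉ Jbar := by
  classical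
  refine ⟨10, fun m hm => ?_⟩
  obtain ⟨E, hE1, hE2, hEA, hEB⟩ := exists_biexpander hm
  have hpos : 0 < 2 * m := by omega
  let g : Fin (4 * m) → Fin (2 * m) := fun j => ⟨j % (2 * m), Nat.mod_lt _ hpos⟩
  have hg1 : ∀ j : Fin (4 * m), (j : ℕ) < 2 * m → (g j : ℕ) = j := fun j hj => Nat.mod_eq_of_lt hj
  have hg2 : ∀ j : Fin (4 * m), ¬ (j : ℕ) < 2 * m → (g j : ℕ) + 2 * m = j := fun j hj => by
    have := j.2
    simp only [g]
    rw [Nat.mod_eq_sub_mod (by omega), Nat.mod_eq_of_lt (by omega)]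
    omega
  refine ⟨({p | E p.1 (g p.2)} : Finset _), fun i => ?_, fun j => ?_, fun Jbar hJ hJm => ?_⟩
  · refine (card_le_mul_card_image (f := fun p => g p.2) _ 2 fun v _ => ?_).trans ?_
    · refine (card_le_card_of_injOn (t := (univ : Finset Bool))
        (fun p => decide ((p.2 : ℕ) < 2 * m)) (fun _ _ => mem_univ _) ?_).trans (by simp)
      intro x hx y hy hxy
      simp only [coe_filter, mem_filter, mem_univ, true_and, Set.mem_ofPred_eq] at hx hy
      refine Prod.ext (hx.1.2.trans hy.1.2.symm) (Fin.ext ?_)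
      have hgg : (g x.2 : ℕ) = g y.2 := congrArg Fin.val (hx.2.trans hy.2.symm)
      simp only [decide_eq_decide] at hxy
      by_cases h : (x.2 : ℕ) < 2 * m
      · rw [← hg1 _ h, ← hg1 _ (hxy.1 h), hgg]
      · rw [← hg2 _ h, ← hg2 _ (fun h' => h (hxy.2 h')), hgg]
    · have hsub : ((image (fun p : Fin (3 * m) × Fin (4 * m) => g p.2)
          {p ∈ ({p | E p.1 (g p.2)} : Finset _) | p.1 = i} : Finset _) : Set (Fin (2 * m))) ⊆
          {v | E i v} := by
        intro v hv
        simp only [coe_image, Set.mem_image, mem_coe, mem_filter, mem_univ, true_and] at hv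
        obtain ⟨p, ⟨hp, rfl⟩, rfl⟩ := hv
        exact hp
      have := (Set.ncard_le_ncard hsub).trans (hE1 i)
      rw [Set.ncard_coe_finset] at this
      omega
  · refine le_trans ?_ ((hE2 (g j)).trans (by omega))
    rw [← Set.ncard_coe_finset]
    refine Set.ncard_le_ncard_of_injOn Prod.fst (fun p hp => ?_) fun p hp p' hp' h => ?_
    · simp only [coe_filter, mem_filter, mem_univ, true_and, Set.mem_ofPred_eq] at hp ⊢
      exact hp.2 ▸ hp.1
    · simp only [coe_filter, mem_filter, mem_univ, true_and, Set.mem_ofPred_eq] at hp hp'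
      exact Prod.ext h (hp.2.trans hp'.2.symm)
  · let t : Fin (3 * m) → Finset (Fin (4 * m)) := fun i => {j | E i (g j) ∧ j ∉ Jbar}
    obtain ⟨f, hf, hft⟩ := (all_card_le_biUnion_card_iff_exists_injective t).1 fun A => by
      by_cases hA : 2 * #A ≤ 3 * m
      · refine (hEA A hA).trans ?_
        rw [← Set.ncard_coe_finset (A.biUnion t)]
        refine Set.ncard_le_ncard_of_injOn
          (fun v : Fin (2 * m) => (⟨v + 2 * m, by omega⟩ : Fin (4 * m))) ?_ ?_
        · rintro v ⟨i, hi, hv⟩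
          have hgv : g ⟨v + 2 * m, by omega⟩ = v :=
            Fin.ext (by simp [g, Nat.mod_eq_of_lt v.2])
          simp only [t, mem_coe, mem_biUnion, mem_filter, mem_univ, true_and, hgv]
          exact ⟨i, hi, hv, fun h => by have := hJ _ h; simp at this⟩
        · intro v _ w _ h
          simp only [Fin.mk.injEq] at h
          exact Fin.ext (by omega)
      · by_contra! hlt
        have hAle : #A ≤ 3 * m := (card_le_univ A).trans (Fintype.card_fin _).le
        let W : Finset (Fin (4 * m)) := (univ \ Jbar) \ A.biUnion t
        have hW : 3 * m - #A + 1 ≤ #W := by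
          have h1 := le_card_sdiff (A.biUnion t) (univ \ Jbar)
          rw [card_sdiff_of_subset (subset_univ _), card_univ, Fintype.card_fin, hJm] at h1
          simp only [W]
          omega
        have hnbr : ∀ j ∈ W, ∀ i ∈ A, ¬ E i (g j) := by
          intro j hj i hi hE
          simp only [W, t, mem_sdiff, mem_univ, true_and, mem_biUnion, mem_filter, not_exists,
            not_and] at hj
          exact hj.2 i hi hE hj.1
        obtain ⟨W', hW', hinj, hcard⟩ : ∃ W' ⊆ W, Set.InjOn g W' ∧ 3 * m - #A + 1 ≤ 2 * #W' := by
          have hsplit := card_filter_add_card_filter_not (s := W) fun j : Fin (4 * m) => (j : ℕ) < 2 * m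
          by_cases hc : 3 * m - #A + 1 ≤ 2 * #(W.filter fun j : Fin (4 * m) => (j : ℕ) < 2 * m)
          · refine ⟨_, filter_subset _ _, fun x hx y hy h => Fin.ext ?_, hc⟩
            simp only [coe_filter, Set.mem_ofPred_eq] at hx hy
            rw [← hg1 _ hx.2, ← hg1 _ hy.2, h]
          · refine ⟨W.filter fun j : Fin (4 * m) => ¬ (j : ℕ) < 2 * m, filter_subset _ _,
              fun x hx y hy h => Fin.ext ?_, by omega⟩
            simp only [coe_filter, Set.mem_ofPred_eq] at hx hy
            rw [← hg2 _ hx.2, ← hg2 _ hy.2, h]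
        obtain ⟨B, hB, hBc⟩ := exists_subset_card_eq (s := W'.image g) (n := (3 * m - #A + 2) / 2)
          (by rw [card_image_of_injOn hinj]; omega)
        have hexp := hEB B (by omega)
        have hsub : {i | ∃ v ∈ B, E i v} ⊆ ((univ \ A : Finset _) : Set (Fin (3 * m))) := by
          rintro i ⟨v, hv, hE⟩
          obtain ⟨j, hj, rfl⟩ := mem_image.1 (hB hv)
          simp only [mem_coe, mem_sdiff, mem_univ, true_and]
          exact fun hi => hnbr j (hW' hj) i hi hE
        have hle := Set.ncard_le_ncard hsub
        rw [Set.ncard_coe_finset, card_sdiff_of_subset (subset_univ _), card_univ,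
          Fintype.card_fin] at hle
        omega
    refine ⟨f, hf, fun i => ?_⟩
    have := hft i
    simpa [t] using this
end

section
/- Let s ≥ 2 and m ≥ 1 be integers, let G be a graph, and let S = (T, P₁, A, P₂, Z, Z₁) be an absorbing structure in G for cycles of length s + 2 with flexibility m. Then for every subset Z̄ ⊆ Z₁ with |Z̄| = m, the induced subgraph of G on V(S) ∖ Z̄ contains a C_{s+2}-factor, i.e., a collection of vertex-disjoint cycles of length s + 2 covering every vertex of V(S) ∖ Z̄. (Here V(S) denotes the union of the vertex sets of all paths in P₁ and P₂ together with A and Z.) -/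
open Finset

/-- An absorbing structure in `G` for cycles of length `s + 2` with flexibility `m`.
The template `T` is a bipartite graph with parts `I = Fin (3m)` and `J = Fin (4m)`
(its flexible set `J₁` being `{j | (j : ℕ) < 2m}`), such that removing any `m` flexible
vertices leaves a graph with a perfect matching. `P₁ = {P¹,…,P^{3m}}` and
`P₂ = {P_{ij} : (i,j) ∈ E(T)}` are families of pairwise vertex-disjoint paths of length
`s` in `G`, `A = {a_{ij}}` and `Z = {z₁,…,z_{4m}}` are sets of distinct vertices, the
vertex sets `V(P₁), V(P₂), A, Z` are pairwise disjoint, and for every `(i,j) ∈ E(T)`,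
`a_{ij}` is adjacent to both ends of `Pⁱ` and of `P_{ij}`, and `z_j` is adjacent to both
ends of `P_{ij}`. -/
structure AbsorbingStructure {V : Type} [Fintype V] [DecidableEq V] (G : SimpleGraph V)
    (s m : ℕ) where
  /-- The edge set of the template. -/
  T : Finset (Fin (3 * m) × Fin (4 * m))
  /-- The template property: removing any `m` vertices of the flexible set `J₁` leaves
  a graph with a perfect matching. -/
  template : ∀ Jbar : Finset (Fin (4 * m)),
    (∀ j ∈ Jbar, (j : ℕ) < 2 * m) → Jbar.card = m →
    ∃ f : Fin (3 * m) → Fin (4 * m), Function.Injective f ∧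
      ∀ i, (i, f i) ∈ T ∧ f i ∉ Jbar
  /-- The left endpoints of the paths `Pⁱ`. -/
  pA : Fin (3 * m) → V
  /-- The right endpoints of the paths `Pⁱ`. -/
  pB : Fin (3 * m) → V
  /-- The paths `P¹, …, P^{3m}` of `P₁`. -/
  P1 : ∀ i, G.Walk (pA i) (pB i)
  P1_path : ∀ i, (P1 i).IsPath
  P1_len : ∀ i, (P1 i).length = s
  /-- The left endpoints of the paths `P_{ij}`. -/
  qA : Fin (3 * m) × Fin (4 * m) → V
  /-- The right endpoints of the paths `P_{ij}`. -/
  qB : Fin (3 * m) × Fin (4 * m) → V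
  /-- The paths `P_{ij}`, `(i,j) ∈ E(T)`, of `P₂`. -/
  P2 : ∀ e, G.Walk (qA e) (qB e)
  P2_path : ∀ e ∈ T, (P2 e).IsPath
  P2_len : ∀ e ∈ T, (P2 e).length = s
  /-- The vertices `a_{ij}`, `(i,j) ∈ E(T)`. -/
  a : Fin (3 * m) × Fin (4 * m) → V
  /-- The vertices `z₁, …, z_{4m}`. -/
  z : Fin (4 * m) → V
  P1_disj : ∀ i j, i ≠ j →
    Disjoint (P1 i).support.toFinset (P1 j).support.toFinset
  P2_disj : ∀ e ∈ T, ∀ e' ∈ T, e ≠ e' →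
    Disjoint (P2 e).support.toFinset (P2 e').support.toFinset
  a_inj : ∀ e ∈ T, ∀ e' ∈ T, a e = a e' → e = e'
  z_inj : Function.Injective z
  /-- The vertex sets `V(P₁)`, `V(P₂)`, `A` and `Z` are pairwise disjoint. -/
  global_disj : List.Pairwise Disjoint
    [Finset.univ.biUnion (fun i => (P1 i).support.toFinset),
     T.biUnion (fun e => (P2 e).support.toFinset),
     T.image a,
     Finset.univ.image z]
  adj_a_P1 : ∀ e ∈ T, G.Adj (a e) (pA e.1) ∧ G.Adj (a e) (pB e.1)
  adj_a_P2 : ∀ e ∈ T, G.Adj (a e) (qA e) ∧ G.Adj (a e) (qB e)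
  adj_z_P2 : ∀ e ∈ T, G.Adj (z e.2) (qA e) ∧ G.Adj (z e.2) (qB e)

/-- The vertex set `V(S)` of an absorbing structure: all vertices of the paths of `P₁`
and `P₂` together with `A` and `Z`. -/
def AbsorbingStructure.verts {V : Type} [Fintype V] [DecidableEq V] {G : SimpleGraph V}
    {s m : ℕ} (S : AbsorbingStructure G s m) : Finset V :=
  Finset.univ.biUnion (fun i => (S.P1 i).support.toFinset) ∪
    S.T.biUnion (fun e => (S.P2 e).support.toFinset) ∪
    S.T.image S.a ∪ Finset.univ.image S.z

/-- The set `Z₁ = {z₁, …, z_{2m}}` of an absorbing structure. -/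
def AbsorbingStructure.Z1 {V : Type} [Fintype V] [DecidableEq V] {G : SimpleGraph V}
    {s m : ℕ} (S : AbsorbingStructure G s m) : Finset V :=
  (Finset.univ.filter fun j : Fin (4 * m) => (j : ℕ) < 2 * m).image S.z

/-- Joining both ends of a path of positive length to a new vertex gives a cycle. -/
theorem SimpleGraph.Walk.IsPath.exists_isCycle_of_adj_ends {V : Type*} {G : SimpleGraph V}
    {x y w : V} {p : G.Walk x y} (hp : p.IsPath) (hlen : 1 ≤ p.length) (hw : w ∉ p.support)
    (hx : G.Adj w x) (hy : G.Adj w y) :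
    ∃ c : G.Walk w w, c.IsCycle ∧ c.length = p.length + 2 ∧
      ∀ v, v ∈ c.support ↔ v = w ∨ v ∈ p.support := by
  refine ⟨.cons hx (p.concat hy.symm), ?_, by simp, fun v ↦ ?_⟩
  · rw [SimpleGraph.Walk.cons_isCycle_iff]
    refine ⟨hp.concat hw hy.symm, ?_⟩
    have hxy : x ≠ y := by
      rintro rfl
      rw [SimpleGraph.Walk.isPath_iff_nil.1 hp |>.eq_nil] at hlen
      simp at hlen
    rw [SimpleGraph.Walk.edges_concat, List.concat_eq_append, List.mem_append]
    rintro (h | h)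
    · exact hw (p.fst_mem_support_of_mem_edges h)
    · simp only [List.mem_singleton, Sym2.eq_iff] at h
      grind
  · simp only [SimpleGraph.Walk.support_cons, SimpleGraph.Walk.support_concat]
    grind

/-- A family of disjoint paths, each closed up to a cycle by a vertex of its own, reindexed
by an initial segment of the naturals. -/
theorem SimpleGraph.exists_disjoint_cycles_of_paths {V ι : Type*} [DecidableEq V] [Fintype ι]
    {G : SimpleGraph V} {s : ℕ} (hs : 1 ≤ s) {x y w : ι → V} (p : ∀ i, G.Walk (x i) (y i))
    (hp : ∀ i, (p i).IsPath) (hlen : ∀ i, (p i).length = s)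
    (hx : ∀ i, G.Adj (w i) (x i)) (hy : ∀ i, G.Adj (w i) (y i))
    (hpp : ∀ i j, ∀ v ∈ (p i).support, v ∈ (p j).support → i = j)
    (hw : Function.Injective w) (hwp : ∀ i j, w i ∉ (p j).support) (U : Finset V)
    (hU : ∀ v, v ∈ U ↔ ∃ i, v = w i ∨ v ∈ (p i).support) :
    ∃ (t : ℕ) (v : Fin t → V) (c : ∀ i, G.Walk (v i) (v i)),
      (∀ i, (c i).IsCycle ∧ (c i).length = s + 2 ∧ ∀ x ∈ (c i).support, x ∈ U) ∧
      (∀ i j, i ≠ j → Disjoint (c i).support.toFinset (c j).support.toFinset) ∧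
      ∀ x ∈ U, ∃ i, x ∈ (c i).support := by
  choose c hc hcl hcs using fun i ↦
    (hp i).exists_isCycle_of_adj_ends (by rw [hlen]; exact hs) (hwp i i) (hx i) (hy i)
  let e := (Fintype.equivFin ι).symm
  refine ⟨Fintype.card ι, fun i ↦ w (e i), fun i ↦ c (e i), fun i ↦ ⟨hc _, ?_, ?_⟩, ?_, ?_⟩
  · rw [hcl, hlen]
  · intro v hv
    exact (hU v).2 ⟨e i, (hcs _ _).1 hv⟩
  · intro i j hij
    rw [Finset.disjoint_left]
    intro v hvi hvj
    rw [List.mem_toFinset, hcs] at hvi hvj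
    apply hij
    apply e.injective
    rcases hvi with hvi | hvi <;> rcases hvj with hvj | hvj
    · exact hw (hvi.symm.trans hvj)
    · exact absurd (hvi ▸ hvj) (hwp _ _)
    · exact absurd (hvj ▸ hvi) (hwp _ _)
    · exact hpp _ _ v hvi hvj
  · intro v hv
    obtain ⟨i, hi⟩ := (hU v).1 hv
    refine ⟨e.symm i, ?_⟩
    rw [hcs, e.apply_symm_apply]
    exact hi

/-- if `S` is an absorbing structure in `G` for cycles of length `s + 2`
with flexibility `m` (`s ≥ 2`, `m ≥ 1`), then for every `Z̄ ⊆ Z₁` with `|Z̄| = m`, the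
set `V(S) ∖ Z̄` has a `C_{s+2}`-factor in `G`: vertex-disjoint cycles of length `s + 2`
covering exactly `V(S) ∖ Z̄`. -/
theorem stmt17 {V : Type} [Fintype V] [DecidableEq V] (G : SimpleGraph V)
    (s m : ℕ) (hs : 2 ≤ s) (hm : 1 ≤ m) (S : AbsorbingStructure G s m)
    (Zbar : Finset V) (hZ : Zbar ⊆ S.Z1) (hZcard : Zbar.card = m) :
    ∃ (t : ℕ) (v : Fin t → V) (c : ∀ i, G.Walk (v i) (v i)),
      (∀ i, (c i).IsCycle ∧ (c i).length = s + 2 ∧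
        ∀ x ∈ (c i).support, x ∈ S.verts \ Zbar) ∧
      (∀ i j, i ≠ j → Disjoint (c i).support.toFinset (c j).support.toFinset) ∧
      ∀ x ∈ S.verts \ Zbar, ∃ i, x ∈ (c i).support := by
  let Jbar : Finset (Fin (4 * m)) := {j | S.z j ∈ Zbar}
  have hJ : ∀ j, j ∈ Jbar ↔ S.z j ∈ Zbar := by simp [Jbar]
  have hZ' : ∀ v ∈ Zbar, ∃ j : Fin (4 * m), (j : ℕ) < 2 * m ∧ S.z j = v := by
    intro v hv
    simpa [AbsorbingStructure.Z1] using hZ hv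
  have hJcard : Jbar.card = m := by
    refine Eq.trans ?_ hZcard
    rw [← Finset.card_image_of_injective Jbar S.z_inj]
    congr 1
    ext v
    grind
  obtain ⟨f, hf, hfT⟩ := S.template Jbar (by
    intro j hj
    obtain ⟨k, hk, hkj⟩ := hZ' _ ((hJ j).1 hj)
    rwa [← S.z_inj hkj]) hJcard
  have hfsurj : ∀ j, j ∉ Jbar → ∃ i, f i = j := by
    have himg : Finset.univ.image f = Jbarᶜ := by
      apply Finset.eq_of_subset_of_card_le
      · intro j hj
        obtain ⟨i, -, rfl⟩ := Finset.mem_image.1 hj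
        exact Finset.mem_compl.2 (hfT i).2
      · rw [Finset.card_image_of_injective _ hf, Finset.card_compl, hJcard]
        simp only [Fintype.card_fin, Finset.card_univ]
        omega
    intro j hj
    have : j ∈ Finset.univ.image f := himg ▸ Finset.mem_compl.2 hj
    simpa using this
  have hd := S.global_disj
  simp only [List.pairwise_cons, List.mem_cons, forall_eq_or_imp, Finset.disjoint_left,
    Finset.mem_biUnion, Finset.mem_image, Finset.mem_univ, true_and, List.mem_toFinset,
    List.not_mem_nil, forall_exists_index, and_imp, not_exists,
    not_and] at hd
  obtain ⟨⟨h12, h1a, h1z, -⟩, ⟨h2a, h2z, -⟩, ⟨haz, -⟩, -⟩ := hd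
  have h11 := S.P1_disj
  have h22 := S.P2_disj
  simp only [Finset.disjoint_left, List.mem_toFinset] at h11 h22
  -- Matched edges close `Pⁱ` with `a_{ij}` and `P_{ij}` with `z_j`; the others close
  -- `P_{ij}` with `a_{ij}`.
  let w : Fin (3 * m) ⊕ {e // e ∈ S.T} → V := Sum.elim (fun i ↦ S.a (i, f i))
    (fun e ↦ if f e.1.1 = e.1.2 then S.z e.1.2 else S.a e.1)
  let x : Fin (3 * m) ⊕ {e // e ∈ S.T} → V := Sum.elim S.pA (fun e ↦ S.qA e.1)
  let y : Fin (3 * m) ⊕ {e // e ∈ S.T} → V := Sum.elim S.pB (fun e ↦ S.qB e.1)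
  let p : ∀ k, G.Walk (x k) (y k) := fun k ↦
    match k with
    | .inl i => S.P1 i
    | .inr e => S.P2 e.1
  have hw1 : ∀ i, w (.inl i) = S.a (i, f i) := fun _ ↦ rfl
  have hw2 : ∀ e : {e // e ∈ S.T},
      w (.inr e) = if f e.1.1 = e.1.2 then S.z e.1.2 else S.a e.1 := fun _ ↦ rfl
  have hp1 : ∀ i, (p (.inl i)).support = (S.P1 i).support := fun _ ↦ rfl
  have hp2 : ∀ e : {e // e ∈ S.T}, (p (.inr e)).support = (S.P2 e.1).support := fun _ ↦ rfl
  refine SimpleGraph.exists_disjoint_cycles_of_paths (w := w) (by omega) p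
    ?_ ?_ ?_ ?_ ?_ ?_ ?_ _ ?_
  · rintro (i | e)
    exacts [S.P1_path i, S.P2_path e.1 e.2]
  · rintro (i | e)
    exacts [S.P1_len i, S.P2_len e.1 e.2]
  · rintro (i | e)
    · exact (S.adj_a_P1 _ (hfT i).1).1
    · rw [hw2]
      split_ifs
      exacts [(S.adj_z_P2 _ e.2).1, (S.adj_a_P2 _ e.2).1]
  · rintro (i | e)
    · exact (S.adj_a_P1 _ (hfT i).1).2
    · rw [hw2]
      split_ifs
      exacts [(S.adj_z_P2 _ e.2).2, (S.adj_a_P2 _ e.2).2]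
  · rintro (i | e) (j | e') v hv hv' <;> simp only [hp1, hp2] at hv hv'
    · by_contra hne
      exact h11 i j (by grind) hv hv'
    · exact (h12 i hv e'.1 e'.2 hv').elim
    · exact (h12 j hv' e.1 e.2 hv).elim
    · by_contra hne
      exact h22 e.1 e.2 e'.1 e'.2 (by grind) hv hv'
  · rintro (i | ⟨⟨i, j⟩, he⟩) (i' | ⟨⟨i', j'⟩, he'⟩) h <;> simp only [hw1, hw2] at h
    · have := S.a_inj _ (hfT i).1 _ (hfT i').1 h
      grind
    · have := S.a_inj _ (hfT i).1 _ he'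
      have := haz _ (hfT i).1 rfl
      grind
    · have := S.a_inj _ (hfT i').1 _ he
      have := haz _ (hfT i').1 rfl
      grind
    · have := S.a_inj _ he _ he'
      have := haz _ he rfl
      have := haz _ he' rfl
      have := @S.z_inj j j'
      have := @hf i i'
      split_ifs at h <;> grind
  · rintro (i | e) (j | e') h <;> simp only [hw1, hw2, hp1, hp2] at h
    · exact h1a _ h _ (hfT i).1 rfl
    · exact h2a _ e'.2 h _ (hfT i).1 rfl
    · split_ifs at h
      exacts [h1z _ h _ rfl, h1a _ h _ e.2 rfl]
    · split_ifs at h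
      exacts [h2z _ e'.2 h _ rfl, h2a _ e'.2 h _ e.2 rfl]
  · intro v
    simp only [AbsorbingStructure.verts, Finset.mem_sdiff, Finset.mem_union, Finset.mem_biUnion,
      Finset.mem_image, Finset.mem_univ, true_and, List.mem_toFinset, Sum.exists, hw1, hw2, hp1,
      hp2]
    constructor
    · rintro ⟨((⟨i, hi⟩ | ⟨e, he, hv⟩) | ⟨⟨i, j⟩, he, rfl⟩) | ⟨j, rfl⟩, hvZ⟩
      · exact .inl ⟨i, .inr hi⟩
      · exact .inr ⟨⟨e, he⟩, .inr hv⟩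
      · by_cases hij : f i = j
        · exact .inl ⟨i, .inl (by rw [hij])⟩
        · exact .inr ⟨⟨(i, j), he⟩, .inl (by simp [hij])⟩
      · obtain ⟨i, rfl⟩ := hfsurj j (by rwa [hJ])
        exact .inr ⟨⟨(i, f i), (hfT i).1⟩, .inl (by simp)⟩
    · have hne : ∀ v, (∀ j, S.z j ≠ v) → v ∉ Zbar := fun v h hv ↦ by
        obtain ⟨j, -, hj⟩ := hZ' v hv
        exact h j hj
      rintro (⟨i, rfl | hv⟩ | ⟨e, h | hv⟩)
      · exact ⟨.inl (.inr ⟨_, (hfT i).1, rfl⟩), hne _ fun j hj ↦ haz _ (hfT i).1 rfl j hj⟩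
      · exact ⟨.inl (.inl (.inl ⟨i, hv⟩)), hne _ fun j hj ↦ h1z i hv j hj⟩
      · split_ifs at h with hfe
        · refine ⟨.inr ⟨_, h.symm⟩, ?_⟩
          rw [h, ← hJ, ← hfe]
          exact (hfT _).2
        · exact ⟨.inl (.inr ⟨_, e.2, h.symm⟩), hne _ fun j hj ↦ haz _ e.2 h.symm j hj⟩
      · exact ⟨.inl (.inl (.inr ⟨_, e.2, hv⟩)), hne _ fun j hj ↦ h2z _ e.2 hv j hj⟩
end
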